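/- Nonexistence under integrability of the positive part of a (Euclidean case): Let m ≥ 3, let a : ℝ^m → ℝ be Hölder continuous with a₊ = max(a,0) Lebesgue-integrable on ℝ^m, and let b : ℝ^m → ℝ be continuous with b > 0. Suppose σ > 1, A ≤ −1, and μ, p, q satisfy q > max{1, 3−σ}, 0 ≤ μ ≤ 2(σ−1)/(σ+q−2), p > (q+σ−2)/(σ−1). Assume ∫_{B_r} a₊^p dx = O( r^{[2(σ−1)−μ(q+σ−2)](p−1)/(q−1)} ) as r → +∞, that m ≤ 2 + (2−μ)(σ+q−2)/(σ−1) (so that vol B_r = O(r^{2+(2−μ)(σ+q−2)/(σ−1)})), and that b(x) ≥ C|x|^{−μ} for all sufficiently large |x|, for some C > 0. Then there is no nonnegative, not identically zero, C² function u on ℝ^m satisfying u Δu + a(x) u² ≥ b(x) u^{σ+1} − A |∇u|² on ℝ^m. -/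

import Mathlib

open MeasureTheory Metric Set Filter

/-- The Euclidean Laplacian: the sum of the unmixed second partial derivatives. -/
noncomputable def lap {m : ℕ} (u : EuclideanSpace ℝ (Fin m) → ℝ) (x : EuclideanSpace ℝ (Fin m)) : ℝ :=
  ∑ i : Fin m, fderiv ℝ (fun y => fderiv ℝ u y (EuclideanSpace.single i 1)) x (EuclideanSpace.single i 1)


lemma second_deriv_test {f f' : ℝ → ℝ} {f'' : ℝ} (hmax : IsLocalMax f 0)
    (h1 : ∀ᶠ t in nhds (0:ℝ), HasDerivAt f (f' t) t) (h2 : HasDerivAt f' f'' 0) : f'' ≤ 0 := by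
  by_contra hpos
  push Not at hpos
  have hd : deriv f =ᶠ[nhds 0] f' := h1.mono fun t ht => ht.deriv
  have hdd : deriv (deriv f) 0 = f'' := by
    rw [hd.deriv_eq]; exact h2.deriv
  have hmin := isLocalMin_of_deriv_deriv_pos (f := f) (x₀ := 0) (by rw [hdd]; exact hpos)
    hmax.deriv_eq_zero h1.self_of_nhds.continuousAt
  have hconst : f =ᶠ[nhds 0] fun _ => f 0 := by
    filter_upwards [hmax, hmin] with t ht1 ht2
    exact le_antisymm ht1 ht2
  have h3 : deriv f =ᶠ[nhds 0] fun _ => 0 := by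
    have := hconst.deriv
    refine this.trans ?_
    filter_upwards with t
    simp
  have : deriv (deriv f) 0 = 0 := by
    rw [h3.deriv_eq]; simp
  linarith

lemma norm_gradient_sq {m : ℕ} (u : EuclideanSpace ℝ (Fin m) → ℝ) (x : EuclideanSpace ℝ (Fin m)) :
    ‖gradient u x‖ ^ 2 = ∑ i, (fderiv ℝ u x (EuclideanSpace.single i 1)) ^ 2 := by
  rw [EuclideanSpace.norm_sq_eq]
  refine Finset.sum_congr rfl fun i _ => ?_
  rw [← inner_gradient_left, EuclideanSpace.inner_single_right]
  simp

noncomputable def kQ {m : ℕ} (ε : ℝ) (w : EuclideanSpace ℝ (Fin m)) : ℝ := ‖w‖ ^ 2 + ε ^ 2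
noncomputable def k0 {m : ℕ} (ε s : ℝ) (w : EuclideanSpace ℝ (Fin m)) : ℝ := kQ ε w ^ (-s)
noncomputable def k1 {m : ℕ} (ε s : ℝ) (i : Fin m) (w : EuclideanSpace ℝ (Fin m)) : ℝ :=
  -2 * s * w i * kQ ε w ^ (-s - 1)
noncomputable def k2 {m : ℕ} (ε s : ℝ) (i : Fin m) (w : EuclideanSpace ℝ (Fin m)) : ℝ :=
  -2 * s * kQ ε w ^ (-s - 1) + 4 * s * (s + 1) * (w i) ^ 2 * kQ ε w ^ (-s - 2)

lemma hasDerivAt_norm_sq {m : ℕ} (z : EuclideanSpace ℝ (Fin m)) (i : Fin m) (t : ℝ) :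
    HasDerivAt (fun t : ℝ => ‖z + t • EuclideanSpace.single i (1:ℝ)‖ ^ 2)
      (2 * (z + t • EuclideanSpace.single i (1:ℝ)) i) t := by
  have : (fun t : ℝ => ‖z + t • EuclideanSpace.single i (1:ℝ)‖ ^ 2) =
      fun t => ‖z‖ ^ 2 + 2 * (t * z i) + t ^ 2 := by
    funext t
    rw [norm_add_sq_real, inner_smul_right, EuclideanSpace.inner_single_right, norm_smul]
    simp
  rw [this]
  have h := ((((hasDerivAt_id t).mul_const (z i)).const_mul 2).const_add (‖z‖ ^ 2)).add
    ((hasDerivAt_id t).pow 2)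
  refine h.congr_deriv ?_
  simp
  ring

lemma hasDerivAt_coord {m : ℕ} (z : EuclideanSpace ℝ (Fin m)) (i : Fin m) (t : ℝ) :
    HasDerivAt (fun t : ℝ => (z + t • EuclideanSpace.single i (1:ℝ)) i) 1 t := by
  have : (fun t : ℝ => (z + t • EuclideanSpace.single i (1:ℝ)) i) = fun t => z i + t := by
    funext t; simp
  rw [this]
  exact (hasDerivAt_id t).const_add _

lemma kQ_pos {m : ℕ} {ε : ℝ} (hε : 0 < ε) (w : EuclideanSpace ℝ (Fin m)) : 0 < kQ ε w := by
  unfold kQ; positivity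

lemma kQ_cont {m : ℕ} {ε : ℝ} : Continuous (kQ ε : EuclideanSpace ℝ (Fin m) → ℝ) := by
  unfold kQ; fun_prop

lemma kQ_rpow_cont {m : ℕ} {ε : ℝ} (hε : 0 < ε) (r : ℝ) :
    Continuous (fun w : EuclideanSpace ℝ (Fin m) => kQ ε w ^ r) :=
  kQ_cont.rpow_const fun w => Or.inl (kQ_pos hε w).ne'

lemma k0_cont {m : ℕ} {ε s : ℝ} (hε : 0 < ε) : Continuous (k0 ε s : EuclideanSpace ℝ (Fin m) → ℝ) :=
  kQ_rpow_cont hε _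

lemma k1_cont {m : ℕ} {ε s : ℝ} (hε : 0 < ε) (i : Fin m) : Continuous (k1 ε s i) := by
  unfold k1
  have := kQ_rpow_cont (m := m) hε (-s - 1)
  fun_prop

lemma k2_cont {m : ℕ} {ε s : ℝ} (hε : 0 < ε) (i : Fin m) : Continuous (k2 ε s i) := by
  unfold k2
  have := kQ_rpow_cont (m := m) hε (-s - 1)
  have := kQ_rpow_cont (m := m) hε (-s - 2)
  fun_prop

lemma hasDerivAt_kQ_rpow {m : ℕ} {ε : ℝ} (hε : 0 < ε) (r : ℝ) (z : EuclideanSpace ℝ (Fin m))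
    (i : Fin m) (t : ℝ) :
    HasDerivAt (fun t : ℝ => kQ ε (z + t • EuclideanSpace.single i (1:ℝ)) ^ r)
      (2 * (z + t • EuclideanSpace.single i (1:ℝ)) i * r *
        kQ ε (z + t • EuclideanSpace.single i (1:ℝ)) ^ (r - 1)) t := by
  have h := (hasDerivAt_norm_sq z i t).add_const (ε ^ 2)
  exact h.rpow_const (Or.inl (kQ_pos hε _).ne')

lemma hasDerivAt_k0 {m : ℕ} {ε s : ℝ} (hε : 0 < ε) (z : EuclideanSpace ℝ (Fin m))
    (i : Fin m) (t : ℝ) :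
    HasDerivAt (fun t : ℝ => k0 ε s (z + t • EuclideanSpace.single i (1:ℝ)))
      (k1 ε s i (z + t • EuclideanSpace.single i (1:ℝ))) t := by
  refine (hasDerivAt_kQ_rpow hε (-s) z i t).congr_deriv ?_
  unfold k1; ring

lemma hasDerivAt_k1 {m : ℕ} {ε s : ℝ} (hε : 0 < ε) (z : EuclideanSpace ℝ (Fin m))
    (i : Fin m) (t : ℝ) :
    HasDerivAt (fun t : ℝ => k1 ε s i (z + t • EuclideanSpace.single i (1:ℝ)))
      (k2 ε s i (z + t • EuclideanSpace.single i (1:ℝ))) t := by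
  have h := ((hasDerivAt_coord z i t).const_mul (-2 * s)).mul (hasDerivAt_kQ_rpow hε (-s - 1) z i t)
  refine h.congr_deriv ?_
  unfold k2
  rw [show -s - 1 - 1 = -s - 2 by ring]
  ring

lemma abs_coord_le {m : ℕ} (w : EuclideanSpace ℝ (Fin m)) (i : Fin m) : |w i| ≤ ‖w‖ := by
  simpa using PiLp.norm_apply_le w i

lemma kQ_rpow_le {m : ℕ} {ε r : ℝ} (hε : 0 < ε) (hr : r ≤ 0) (w : EuclideanSpace ℝ (Fin m)) :
    kQ ε w ^ r ≤ (ε ^ 2) ^ r :=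
  Real.rpow_le_rpow_of_nonpos (by positivity) (by unfold kQ; nlinarith [sq_nonneg ‖w‖]) hr

lemma kQ_mul_rpow {m : ℕ} {ε : ℝ} (hε : 0 < ε) (r : ℝ) (w : EuclideanSpace ℝ (Fin m)) :
    kQ ε w ^ r = kQ ε w * kQ ε w ^ (r - 1) := by
  rw [Real.rpow_sub_one (kQ_pos hε w).ne']
  field_simp [(kQ_pos hε w).ne']

lemma k0_bound {m : ℕ} {ε s : ℝ} (hε : 0 < ε) (hs : 0 < s) (w : EuclideanSpace ℝ (Fin m)) :
    |k0 ε s w| ≤ (ε ^ 2) ^ (-s) := by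
  unfold k0
  rw [abs_of_pos (Real.rpow_pos_of_pos (kQ_pos hε w) _)]
  exact kQ_rpow_le hε (by linarith) w

lemma k1_bound {m : ℕ} {ε s : ℝ} (hε : 0 < ε) (hs : 0 < s) (i : Fin m)
    (w : EuclideanSpace ℝ (Fin m)) :
    |k1 ε s i w| ≤ 2 * s * ε⁻¹ * (ε ^ 2) ^ (-s) := by
  unfold k1
  have hp := Real.rpow_pos_of_pos (kQ_pos hε w) (-s - 1)
  have h1 := kQ_mul_rpow hε (-s) w
  have h2 := kQ_rpow_le (r := -s) hε (by linarith) w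
  have h3 : |w i| ≤ ε⁻¹ * kQ ε w := by
    rw [inv_mul_eq_div, le_div_iff₀ hε]
    have := abs_coord_le w i
    unfold kQ
    nlinarith [sq_nonneg (‖w‖ - ε), norm_nonneg w]
  calc |-2 * s * w i * kQ ε w ^ (-s - 1)| = 2 * s * (|w i| * kQ ε w ^ (-s - 1)) := by
        rw [abs_mul, abs_mul, abs_of_pos hp, abs_mul, abs_of_pos hs]; norm_num; ring
    _ ≤ 2 * s * ((ε⁻¹ * kQ ε w) * kQ ε w ^ (-s - 1)) := by gcongr
    _ = 2 * s * ε⁻¹ * kQ ε w ^ (-s) := by rw [h1]; ring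
    _ ≤ _ := by gcongr

lemma k2_bound {m : ℕ} {ε s : ℝ} (hε : 0 < ε) (hs : 0 < s) (i : Fin m)
    (w : EuclideanSpace ℝ (Fin m)) :
    |k2 ε s i w| ≤ (2 * s + 4 * s * (s + 1)) * (ε ^ 2) ^ (-s - 1) := by
  unfold k2
  have hp := Real.rpow_pos_of_pos (kQ_pos hε w) (-s - 1)
  have hp2 := Real.rpow_pos_of_pos (kQ_pos hε w) (-s - 2)
  have h1 := kQ_mul_rpow hε (-s - 1) w
  rw [show -s - 1 - 1 = -s - 2 by ring] at h1
  have h2 := kQ_rpow_le (r := -s - 1) hε (by linarith) w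
  have h3 : (w i) ^ 2 ≤ kQ ε w := by
    have := abs_coord_le w i
    unfold kQ
    nlinarith [sq_abs (w i), abs_nonneg (w i)]
  refine (abs_add_le _ _).trans ?_
  have e1 : |-2 * s * kQ ε w ^ (-s - 1)| = 2 * s * kQ ε w ^ (-s - 1) := by
    rw [abs_mul, abs_of_pos hp, abs_mul, abs_of_pos hs]; norm_num
  have e2 : |4 * s * (s + 1) * (w i) ^ 2 * kQ ε w ^ (-s - 2)| =
      4 * s * (s + 1) * ((w i) ^ 2 * kQ ε w ^ (-s - 2)) := by
    rw [abs_of_nonneg (by positivity)]; ring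
  rw [e1, e2]
  have h4 : (w i) ^ 2 * kQ ε w ^ (-s - 2) ≤ kQ ε w ^ (-s - 1) := by
    rw [h1]; gcongr
  calc _ ≤ 2 * s * (ε ^ 2) ^ (-s - 1) + 4 * s * (s + 1) * (ε ^ 2) ^ (-s - 1) := by
        gcongr; exact h4.trans h2
    _ = _ := by ring

lemma sum_k2 {m : ℕ} {ε s : ℝ} (hε : 0 < ε) (hs : 2 * s + 2 = m)
    (w : EuclideanSpace ℝ (Fin m)) :
    ∑ i, k2 ε s i w = - (2 * s * m) * (ε ^ 2 * kQ ε w ^ (-s - 2)) := by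
  unfold k2
  have h1 := kQ_mul_rpow hε (-s - 1) w
  rw [show -s - 1 - 1 = -s - 2 by ring] at h1
  have hn : ∑ i, (w i) ^ 2 = ‖w‖ ^ 2 := by
    rw [EuclideanSpace.norm_sq_eq]; simp
  rw [Finset.sum_add_distrib, ← Finset.sum_mul (f := fun i => 4 * s * (s + 1) * (w i) ^ 2), ← Finset.mul_sum,
    ← Finset.mul_sum, hn, h1]
  simp only [Finset.sum_const, Finset.card_univ, Fintype.card_fin, nsmul_eq_mul]
  unfold kQ
  rw [← hs]
  ring

lemma hasDerivAt_conv {m : ℕ} {f : EuclideanSpace ℝ (Fin m) → ℝ} (hf : Integrable f)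
    {K K' : EuclideanSpace ℝ (Fin m) → ℝ} (hK : Continuous K) (hK' : Continuous K') {C C' : ℝ}
    (hC : ∀ w, |K w| ≤ C) (hC' : ∀ w, |K' w| ≤ C') (i : Fin m)
    (hd : ∀ z t, HasDerivAt (fun t : ℝ => K (z + t • EuclideanSpace.single i (1:ℝ)))
      (K' (z + t • EuclideanSpace.single i (1:ℝ))) t) (x : EuclideanSpace ℝ (Fin m)) (t : ℝ) :
    HasDerivAt (fun t : ℝ => ∫ y, K (x + t • EuclideanSpace.single i (1:ℝ) - y) * f y)
      (∫ y, K' (x + t • EuclideanSpace.single i (1:ℝ) - y) * f y) t := by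
  have hm : ∀ (G : EuclideanSpace ℝ (Fin m) → ℝ) (v : EuclideanSpace ℝ (Fin m)), Continuous G →
      AEStronglyMeasurable (fun y => G (v - y) * f y) := fun G v hG =>
    (hG.comp (by fun_prop : Continuous fun y => v - y)).aestronglyMeasurable.mul
      hf.aestronglyMeasurable
  refine (hasDerivAt_integral_of_dominated_loc_of_deriv_le (𝕜 := ℝ) (μ := volume)
    (F := fun (t : ℝ) y => K (x + t • EuclideanSpace.single i (1:ℝ) - y) * f y)
    (F' := fun (t : ℝ) y => K' (x + t • EuclideanSpace.single i (1:ℝ) - y) * f y)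
    (s := Set.univ) (bound := fun y => C' * ‖f y‖) univ_mem ?_ ?_ ?_ ?_ ?_ ?_).2
  · exact Eventually.of_forall fun t => hm K _ hK
  · refine (hf.norm.const_mul C).mono' (hm K _ hK) (Eventually.of_forall fun y => ?_)
    rw [norm_mul]; gcongr; exact hC _
  · exact hm K' _ hK'
  · refine Eventually.of_forall fun y t _ => ?_
    rw [norm_mul]; gcongr; exact hC' _
  · exact hf.norm.const_mul C'
  · refine Eventually.of_forall fun y t _ => ?_
    have := (hd (x - y) t).mul_const (f y)
    simpa only [add_sub_right_comm] using this

lemma integrable_conv {m : ℕ} {f : EuclideanSpace ℝ (Fin m) → ℝ} (hf : Integrable f)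
    {K : EuclideanSpace ℝ (Fin m) → ℝ} (hK : Continuous K) {C : ℝ}
    (hC : ∀ w, |K w| ≤ C) (x : EuclideanSpace ℝ (Fin m)) :
    Integrable (fun y => K (x - y) * f y) := by
  refine (hf.norm.const_mul C).mono' ?_ (Eventually.of_forall fun y => ?_)
  · exact (hK.comp (by fun_prop : Continuous fun y => x - y)).aestronglyMeasurable.mul
      hf.aestronglyMeasurable
  · rw [norm_mul]; gcongr; exact hC _

lemma continuous_conv {m : ℕ} {f : EuclideanSpace ℝ (Fin m) → ℝ} (hf : Integrable f)
    {K : EuclideanSpace ℝ (Fin m) → ℝ} (hK : Continuous K) {C : ℝ}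
    (hC : ∀ w, |K w| ≤ C) :
    Continuous (fun x => ∫ y, K (x - y) * f y) := by
  refine continuous_of_dominated (bound := fun y => C * ‖f y‖) ?_ ?_ (hf.norm.const_mul C) ?_
  · exact fun x => (integrable_conv hf hK hC x).aestronglyMeasurable
  · refine fun x => Eventually.of_forall fun y => ?_
    rw [norm_mul]; gcongr; exact hC _
  · refine Eventually.of_forall fun y => ?_
    fun_prop

lemma approx_identity {m : ℕ} {f : EuclideanSpace ℝ (Fin m) → ℝ} (hf : Integrable f)
    {C α : ℝ} (hC : 0 ≤ C) (hα : 0 < α) (hα1 : α < 1)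
    (hH : ∀ x y, |f x - f y| ≤ C * ‖x - y‖ ^ α)
    {s : ℝ} (hs0 : 0 < s) (hs : 2 * s + 2 = m) {ε : ℝ} (hε : 0 < ε) (x : EuclideanSpace ℝ (Fin m)) :
    (∫ z : EuclideanSpace ℝ (Fin m), kQ 1 z ^ (-s - 2)) * f x
      - C * ε ^ α * ∫ z : EuclideanSpace ℝ (Fin m), kQ 1 z ^ (-s - 3 / 2)
      ≤ ε ^ 2 * ∫ y, kQ ε (x - y) ^ (-s - 2) * f y := by
  have hi : ∀ r : ℝ, (m : ℝ) < r → Integrable (fun z : EuclideanSpace ℝ (Fin m) => kQ 1 z ^ (-r / 2)) := by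
    intro r hr
    have := integrable_rpow_neg_one_add_norm_sq (E := EuclideanSpace ℝ (Fin m)) (μ := volume) (r := r)
      (by rw [finrank_euclideanSpace_fin]; exact hr)
    unfold kQ
    simpa [add_comm] using this
  have hi2 : Integrable (fun z : EuclideanSpace ℝ (Fin m) => kQ 1 z ^ (-s - 2)) := by
    have := hi (m + 2) (by linarith)
    rwa [← hs, show -(2 * s + 2 + 2) / 2 = -s - 2 by ring] at this
  have hi3 : Integrable (fun z : EuclideanSpace ℝ (Fin m) => kQ 1 z ^ (-s - 3 / 2)) := by
    have := hi (m + 1) (by linarith)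
    rwa [← hs, show -(2 * s + 2 + 1) / 2 = -s - 3 / 2 by ring] at this
  have e1 : ∫ y, kQ ε (x - y) ^ (-s - 2) * f y = ∫ z, kQ ε z ^ (-s - 2) * f (x - z) := by
    rw [← integral_sub_left_eq_self _ volume x]
    simp
  have e2 := Measure.integral_comp_smul (volume : Measure (EuclideanSpace ℝ (Fin m)))
    (fun z => kQ ε z ^ (-s - 2) * f (x - z)) ε
  rw [finrank_euclideanSpace_fin, abs_of_pos (by positivity), smul_eq_mul] at e2
  have e3 : ∀ z : EuclideanSpace ℝ (Fin m), kQ ε (ε • z) ^ (-s - 2) =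
      ε ^ (-(m : ℝ) - 2) * kQ 1 z ^ (-s - 2) := by
    intro z
    have : kQ ε (ε • z) = ε ^ 2 * kQ 1 z := by
      unfold kQ; rw [norm_smul, Real.norm_eq_abs, abs_of_pos hε]; ring
    rw [this, Real.mul_rpow (by positivity) (kQ_pos one_pos z).le, ← Real.rpow_natCast ε 2,
      ← Real.rpow_mul hε.le, ← hs]
    congr 2
    push_cast; ring
  simp_rw [e3, mul_assoc] at e2
  rw [integral_const_mul] at e2
  have e4 : ε ^ (-(m : ℝ) - 2) = (ε ^ m)⁻¹ * (ε ^ 2)⁻¹ := by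
    rw [Real.rpow_sub hε, Real.rpow_neg hε.le, Real.rpow_natCast, ← Real.rpow_natCast ε 2]
    push_cast; rw [div_eq_mul_inv]
  have e5 : ε ^ 2 * ∫ y, kQ ε (x - y) ^ (-s - 2) * f y =
      ∫ z, kQ 1 z ^ (-s - 2) * f (x - ε • z) := by
    rw [e1]
    rw [e4, mul_assoc] at e2
    have h1 := mul_left_cancel₀ (by positivity) e2
    rw [← h1]
    field_simp
  rw [e5, ← integral_mul_const, ← integral_const_mul, ← integral_sub (hi2.mul_const _) (hi3.const_mul _)]
  have hfi : Integrable (fun z => f (x - ε • z)) := by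
    have := (hf.comp_sub_left x).comp_smul hε.ne'
    exact this
  refine integral_mono ((hi2.mul_const _).sub (hi3.const_mul _)) ?_ ?_
  · refine (hfi.norm.const_mul ((1 ^ 2 : ℝ) ^ (-s - 2))).mono' ?_ (Eventually.of_forall fun y => ?_)
    · exact (kQ_rpow_cont one_pos _).aestronglyMeasurable.mul hfi.aestronglyMeasurable
    · rw [norm_mul, Real.norm_of_nonneg (Real.rpow_pos_of_pos (kQ_pos one_pos _) _).le]
      exact mul_le_mul_of_nonneg_right (kQ_rpow_le (r := -s - 2) one_pos (by linarith) y)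
        (norm_nonneg _)
  · intro z
    have hp := Real.rpow_pos_of_pos (kQ_pos one_pos z) (-s - 2)
    have h1 := hH x (x - ε • z)
    rw [sub_sub_cancel, norm_smul, Real.norm_eq_abs, abs_of_pos hε,
      Real.mul_rpow hε.le (norm_nonneg _)] at h1
    have h2 : ‖z‖ ^ α ≤ kQ 1 z ^ (1 / 2 : ℝ) := by
      have h3 : ‖z‖ ^ α ≤ (max 1 ‖z‖) ^ α :=
        Real.rpow_le_rpow (norm_nonneg _) (le_max_right _ _) hα.le
      have h4 : (max 1 ‖z‖) ^ α ≤ max 1 ‖z‖ := by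
        conv_rhs => rw [← Real.rpow_one (max 1 ‖z‖)]
        exact Real.rpow_le_rpow_of_exponent_le (le_max_left _ _) hα1.le
      refine (h3.trans h4).trans ?_
      rw [← Real.sqrt_eq_rpow]
      refine Real.le_sqrt_of_sq_le ?_
      unfold kQ
      rcases max_cases 1 ‖z‖ with h | h <;> rw [h.1] <;> nlinarith [sq_nonneg ‖z‖]
    have h5 : kQ 1 z ^ (-s - 3 / 2) = kQ 1 z ^ (-s - 2) * kQ 1 z ^ (1 / 2 : ℝ) := by
      rw [← Real.rpow_add (kQ_pos one_pos z)]; congr 1; ring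
    have hεα := Real.rpow_pos_of_pos hε α
    have h6 : f x - C * (ε ^ α * kQ 1 z ^ (1 / 2 : ℝ)) ≤ f (x - ε • z) := by
      have := (abs_le.1 h1).2
      have : C * (ε ^ α * ‖z‖ ^ α) ≤ C * (ε ^ α * kQ 1 z ^ (1 / 2 : ℝ)) := by gcongr
      linarith
    change kQ 1 z ^ (-s - 2) * f x - C * ε ^ α * kQ 1 z ^ (-s - 3 / 2) ≤
      kQ 1 z ^ (-s - 2) * f (x - ε • z)
    rw [h5]
    calc _ = kQ 1 z ^ (-s - 2) * (f x - C * (ε ^ α * kQ 1 z ^ (1 / 2 : ℝ))) := by ring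
      _ ≤ _ := by gcongr

lemma newton_bound {m : ℕ} (hm : 3 ≤ m) {f : EuclideanSpace ℝ (Fin m) → ℝ} (hf : Integrable f)
    (hf0 : ∀ x, 0 ≤ f x) (hfc : Continuous f)
    {s : ℝ} (hs0 : 0 < s) (hs : 2 * s + 2 = m) (x : EuclideanSpace ℝ (Fin m)) :
    ∃ M : ℝ, ∀ ε > 0, ∫ y, k0 ε s (x - y) * f y ≤ M := by
  have : Nonempty (Fin m) := ⟨⟨0, by omega⟩⟩
  obtain ⟨B, hB⟩ := (isCompact_closedBall x 1).exists_bound_of_continuousOn hfc.continuousOn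
  set φ : ℝ → ℝ := (Set.Iic (1:ℝ)).indicator (fun r => r ^ (-2 * s)) with hφ
  have hφi : Integrable (fun z : EuclideanSpace ℝ (Fin m) => φ ‖z‖) := by
    rw [integrable_fun_norm_addHaar, finrank_euclideanSpace_fin]
    have h1 : IntegrableOn (fun y : ℝ => y) (Set.Ioc 0 1) :=
      (continuous_id.integrableOn_Icc (a := 0) (b := 1)).mono_set Ioc_subset_Icc_self
    have h2 : Integrable ((Set.Ioc (0:ℝ) 1).indicator (fun y : ℝ => y)) :=
      h1.integrable_indicator measurableSet_Ioc
    refine h2.integrableOn.congr_fun (s := Ioi 0) ?_ measurableSet_Ioi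
    intro y hy
    have hy : 0 < y := hy
    simp only [hφ, Set.indicator, Set.mem_Ioc, Set.mem_Iic, hy, true_and, smul_eq_mul]
    split_ifs
    · rw [← Real.rpow_natCast, ← Real.rpow_add hy]
      rw [show ((m - 1 : ℕ) : ℝ) + -2 * s = 1 by
        rw [Nat.cast_sub (by omega), ← hs]; push_cast; ring]
      simp
    · simp
  refine ⟨∫ y, (B * φ ‖x - y‖ + f y), fun ε hε => ?_⟩
  refine integral_mono_ae (integrable_conv hf (k0_cont hε) (k0_bound hε hs0) x)
    (((hφi.comp_sub_left x).const_mul B).add hf) ?_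
  have hne : ∀ᵐ y ∂(volume : Measure (EuclideanSpace ℝ (Fin m))), y ∉ ({x} : Set _) :=
    measure_eq_zero_iff_ae_notMem.1 (measure_singleton x)
  filter_upwards [hne] with y hyx
  have hk : k0 ε s (x - y) = (‖x - y‖ ^ 2 + ε ^ 2) ^ (-s) := rfl
  change k0 ε s (x - y) * f y ≤ B * φ ‖x - y‖ + f y
  by_cases h : ‖x - y‖ ≤ 1
  · have hfB : f y ≤ B := by
      have := hB y (by rw [mem_closedBall, dist_comm, dist_eq_norm]; exact h)
      exact (le_abs_self _).trans this
    have hB0 : 0 ≤ B := (hf0 y).trans hfB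
    rcases eq_or_lt_of_le (norm_nonneg (x - y)) with h0 | h0
    · exact absurd (sub_eq_zero.1 (norm_eq_zero.1 h0.symm)).symm hyx
    · have h1 : k0 ε s (x - y) ≤ φ ‖x - y‖ := by
        rw [hk, hφ, Set.indicator_of_mem (by exact h)]
        calc (‖x - y‖ ^ 2 + ε ^ 2) ^ (-s) ≤ (‖x - y‖ ^ 2) ^ (-s) :=
              Real.rpow_le_rpow_of_nonpos (by positivity) (by nlinarith [sq_nonneg ε]) (by linarith)
          _ = _ := by
              rw [← Real.rpow_natCast, ← Real.rpow_mul h0.le]; congr 1; push_cast; ring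
      have h2 : 0 ≤ k0 ε s (x - y) := (Real.rpow_pos_of_pos (kQ_pos hε _) _).le
      have := hf0 y
      nlinarith [mul_le_mul h1 hfB (hf0 y) (h2.trans h1)]
  · have h1 : k0 ε s (x - y) ≤ 1 := by
      rw [hk]
      exact Real.rpow_le_one_of_one_le_of_nonpos (by push Not at h; nlinarith [sq_nonneg ε]) (by linarith)
    rw [hφ, Set.indicator_of_notMem (by exact h)]
    have := hf0 y
    nlinarith

lemma potential_exists {m : ℕ} (hm : 3 ≤ m) {f : EuclideanSpace ℝ (Fin m) → ℝ} (hf : Integrable f)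
    (hf0 : ∀ x, 0 ≤ f x) (hfc : Continuous f)
    {C α : ℝ} (hC : 0 ≤ C) (hα : 0 < α) (hα1 : α < 1)
    (hH : ∀ x y, |f x - f y| ≤ C * ‖x - y‖ ^ α) (x₀ : EuclideanSpace ℝ (Fin m)) :
    ∃ M : ℝ, ∀ δ > 0, ∃ (h : EuclideanSpace ℝ (Fin m) → ℝ)
      (h' h'' : Fin m → EuclideanSpace ℝ (Fin m) → ℝ), Continuous h ∧ (∀ x, 0 ≤ h x) ∧ h x₀ ≤ M ∧
      (∀ i x t, HasDerivAt (fun t : ℝ => h (x + t • EuclideanSpace.single i (1:ℝ)))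
        (h' i (x + t • EuclideanSpace.single i (1:ℝ))) t) ∧
      (∀ i x t, HasDerivAt (fun t : ℝ => h' i (x + t • EuclideanSpace.single i (1:ℝ)))
        (h'' i (x + t • EuclideanSpace.single i (1:ℝ))) t) ∧
      ∀ x, ∑ i, h'' i x ≤ - f x + δ := by
  set s : ℝ := ((m : ℝ) - 2) / 2 with hsdef
  have hm' : (3 : ℝ) ≤ m := by exact_mod_cast hm
  have hs0 : 0 < s := by rw [hsdef]; linarith
  have hs : 2 * s + 2 = m := by rw [hsdef]; ring
  obtain ⟨M, hM⟩ := newton_bound hm hf hf0 hfc hs0 hs x₀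
  set J : ℝ := ∫ z : EuclideanSpace ℝ (Fin m), kQ 1 z ^ (-s - 2) with hJ
  set L : ℝ := ∫ z : EuclideanSpace ℝ (Fin m), kQ 1 z ^ (-s - 3 / 2) with hL
  have hL0 : 0 ≤ L := integral_nonneg fun z => (Real.rpow_pos_of_pos (kQ_pos one_pos _) _).le
  have hJ0 : 0 < J := by
    have hi2 : Integrable (fun z : EuclideanSpace ℝ (Fin m) => kQ 1 z ^ (-s - 2)) := by
      have := integrable_rpow_neg_one_add_norm_sq (E := EuclideanSpace ℝ (Fin m)) (μ := volume)
        (r := m + 2) (by rw [finrank_euclideanSpace_fin]; linarith)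
      rw [← hs, show -(2 * s + 2 + 2) / 2 = -s - 2 by ring] at this
      unfold kQ
      simpa [add_comm] using this
    exact integral_pos_of_integrable_nonneg_nonzero (kQ_rpow_cont one_pos _) hi2
      (fun z => (Real.rpow_pos_of_pos (kQ_pos one_pos _) _).le)
      (x := 0) (Real.rpow_pos_of_pos (kQ_pos one_pos _) _).ne'
  set κ : ℝ := 2 * s * m * J with hκ
  have hκ0 : 0 < κ := by positivity
  refine ⟨κ⁻¹ * M, fun δ hδ => ?_⟩
  obtain ⟨ε, hε, hεδ⟩ : ∃ ε : ℝ, 0 < ε ∧ J⁻¹ * (C * ε ^ α * L) ≤ δ := by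
    set D := J⁻¹ * C * L + 1 with hD
    have hD0 : 0 < D := by positivity
    refine ⟨(δ / D) ^ α⁻¹, by positivity, ?_⟩
    rw [← Real.rpow_mul (by positivity), inv_mul_cancel₀ hα.ne', Real.rpow_one]
    calc J⁻¹ * (C * (δ / D) * L) = (D - 1) * (δ / D) := by rw [hD]; ring
      _ ≤ D * (δ / D) := by gcongr; linarith
      _ = δ := by field_simp
  refine ⟨fun x => κ⁻¹ * ∫ y, k0 ε s (x - y) * f y, fun i x => κ⁻¹ * ∫ y, k1 ε s i (x - y) * f y,
    fun i x => κ⁻¹ * ∫ y, k2 ε s i (x - y) * f y, ?_, ?_, ?_, ?_, ?_, ?_⟩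
  · exact continuous_const.mul (continuous_conv hf (k0_cont hε) (k0_bound hε hs0))
  · intro x
    have : 0 ≤ ∫ y, k0 ε s (x - y) * f y := integral_nonneg fun y =>
      mul_nonneg (Real.rpow_pos_of_pos (kQ_pos hε _) _).le (hf0 y)
    positivity
  · have := hM ε hε
    change κ⁻¹ * _ ≤ _
    gcongr
  · intro i x t
    exact (hasDerivAt_conv hf (k0_cont hε) (k1_cont hε i) (k0_bound hε hs0) (k1_bound hε hs0 i) i
      (fun z t => hasDerivAt_k0 hε z i t) x t).const_mul _
  · intro i x t
    exact (hasDerivAt_conv hf (k1_cont hε i) (k2_cont hε i) (k1_bound hε hs0 i) (k2_bound hε hs0 i) i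
      (fun z t => hasDerivAt_k1 hε z i t) x t).const_mul _
  · intro x
    have h1 := approx_identity hf hC hα hα1 hH hs0 hs hε x
    have h2 : ∑ i, κ⁻¹ * ∫ y, k2 ε s i (x - y) * f y =
        -(J⁻¹ * (ε ^ 2 * ∫ y, kQ ε (x - y) ^ (-s - 2) * f y)) := by
      rw [← Finset.mul_sum, ← integral_finsetSum _ fun i _ =>
        integrable_conv hf (k2_cont hε i) (k2_bound hε hs0 i) x]
      simp_rw [← Finset.sum_mul, sum_k2 hε hs, mul_assoc]
      rw [integral_const_mul, integral_const_mul, hκ]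
      have : (m : ℝ) ≠ 0 := by positivity
      field_simp
    have h3 := mul_le_mul_of_nonneg_left h1 (inv_pos.2 hJ0).le
    rw [mul_sub, ← mul_assoc, inv_mul_cancel₀ hJ0.ne', one_mul] at h3
    change ∑ i, κ⁻¹ * ∫ y, k2 ε s i (x - y) * f y ≤ _
    rw [h2]
    linarith

lemma b_lower {m : ℕ} {b : EuclideanSpace ℝ (Fin m) → ℝ}
    (hbcont : Continuous b) (hbpos : ∀ x, 0 < b x) {μ : ℝ} (hμ0 : 0 ≤ μ)
    (hblow : ∃ C > (0:ℝ), ∃ r₀ : ℝ, ∀ x : EuclideanSpace ℝ (Fin m),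
      r₀ ≤ ‖x‖ → C * ‖x‖ ^ (-μ) ≤ b x) :
    ∃ c > 0, ∀ R ≥ (1:ℝ), ∀ x, ‖x‖ ≤ R → c * R ^ (-μ) ≤ b x := by
  obtain ⟨C, hC, r₀, h⟩ := hblow
  obtain ⟨y, -, hy⟩ := (isCompact_closedBall (0 : EuclideanSpace ℝ (Fin m)) (max r₀ 1)).exists_isMinOn
    ⟨0, by simp⟩ hbcont.continuousOn
  refine ⟨min (b y) C, lt_min (hbpos y) hC, fun R hR x hx => ?_⟩
  have hRp : 0 < R ^ (-μ) := Real.rpow_pos_of_pos (by linarith) _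
  by_cases hxr : ‖x‖ ≤ max r₀ 1
  · have h1 : b y ≤ b x := hy (by simpa using hxr)
    have h2 : R ^ (-μ) ≤ 1 := Real.rpow_le_one_of_one_le_of_nonpos hR (by linarith)
    calc min (b y) C * R ^ (-μ) ≤ b y * 1 := by
          gcongr
          · exact (hbpos y).le
          · exact min_le_left _ _
      _ ≤ b x := by linarith
  · push Not at hxr
    have h1 := h x ((le_max_left _ _).trans hxr.le)
    refine le_trans ?_ h1
    have : R ^ (-μ) ≤ ‖x‖ ^ (-μ) := Real.rpow_le_rpow_of_nonpos
      (by linarith [le_max_right r₀ 1]) hx (by linarith)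
    gcongr
    exact min_le_right _ _

lemma log_max_ineq {m : ℕ} {R γ : ℝ} {u h : EuclideanSpace ℝ (Fin m) → ℝ}
    {h' h'' : Fin m → EuclideanSpace ℝ (Fin m) → ℝ} {x : EuclideanSpace ℝ (Fin m)}
    (hu : ContDiff ℝ 2 u) (hx : ‖x‖ ^ 2 < R ^ 2) (hux : 0 < u x)
    (hd1 : ∀ i x t, HasDerivAt (fun t : ℝ => h (x + t • EuclideanSpace.single i (1:ℝ)))
        (h' i (x + t • EuclideanSpace.single i (1:ℝ))) t)
    (hd2 : ∀ i x t, HasDerivAt (fun t : ℝ => h' i (x + t • EuclideanSpace.single i (1:ℝ)))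
        (h'' i (x + t • EuclideanSpace.single i (1:ℝ))) t)
    (hmax : IsLocalMax (fun y => Real.log (u y) - h y + γ * Real.log (R ^ 2 - ‖y‖ ^ 2)) x) :
    lap u x / u x - ‖gradient u x‖ ^ 2 / (u x) ^ 2 - ∑ i, h'' i x
      - γ * (2 * m / (R ^ 2 - ‖x‖ ^ 2) + 4 * ‖x‖ ^ 2 / (R ^ 2 - ‖x‖ ^ 2) ^ 2) ≤ 0 := by
  have hD : 0 < R ^ 2 - ‖x‖ ^ 2 := by linarith
  have hu1 : ∀ y, DifferentiableAt ℝ u y := fun y => (hu.differentiable (by norm_num)) y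
  have key : ∀ i : Fin m,
      fderiv ℝ (fun y => fderiv ℝ u y (EuclideanSpace.single i 1)) x (EuclideanSpace.single i 1) / u x
        - (fderiv ℝ u x (EuclideanSpace.single i 1)) ^ 2 / (u x) ^ 2 - h'' i x
        - γ * (2 / (R ^ 2 - ‖x‖ ^ 2) + 4 * (x i) ^ 2 / (R ^ 2 - ‖x‖ ^ 2) ^ 2) ≤ 0 := by
    intro i
    set e : EuclideanSpace ℝ (Fin m) := EuclideanSpace.single i 1 with he
    have hline : Continuous fun t : ℝ => x + t • e := by fun_prop
    have hl : ∀ t : ℝ, HasDerivAt (fun t : ℝ => x + t • e) e t := fun t => by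
      simpa using ((hasDerivAt_id t).smul_const e).const_add x
    have hl0 : Tendsto (fun t : ℝ => x + t • e) (nhds 0) (nhds x) := by
      have := hline.tendsto 0
      simpa using this
    have d1 : ∀ t : ℝ, HasDerivAt (fun t : ℝ => u (x + t • e)) (fderiv ℝ u (x + t • e) e) t :=
      fun t => (hu1 _).hasFDerivAt.comp_hasDerivAt t (hl t)
    have hu2 : DifferentiableAt ℝ (fun y => fderiv ℝ u y e) x := by
      have : ContDiff ℝ 1 (fderiv ℝ u) := hu.fderiv_right (by norm_num)
      exact ((this.differentiable (by norm_num)).clm_apply (differentiable_const e)) x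
    have d2 : HasDerivAt (fun t : ℝ => fderiv ℝ u (x + t • e) e)
        (fderiv ℝ (fun y => fderiv ℝ u y e) x e) 0 := by
      have h1 : HasFDerivAt (fun y => fderiv ℝ u y e) (fderiv ℝ (fun y => fderiv ℝ u y e) x)
          (x + (0:ℝ) • e) := by simpa using hu2.hasFDerivAt
      exact h1.comp_hasDerivAt 0 (hl 0)
    have n1 : ∀ t : ℝ, HasDerivAt (fun t : ℝ => R ^ 2 - ‖x + t • e‖ ^ 2) (-(2 * (x + t • e) i)) t :=
      fun t => (hasDerivAt_norm_sq x i t).const_sub _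
    have n2 : HasDerivAt (fun t : ℝ => -(2 * (x + t • e) i)) (-(2 * 1)) 0 :=
      ((hasDerivAt_coord x i 0).const_mul 2).neg
    have ev1 : ∀ᶠ t in nhds (0:ℝ), 0 < u (x + t • e) :=
      hl0.eventually (hu.continuous.continuousAt.eventually (lt_mem_nhds hux))
    have ev2 : ∀ᶠ t in nhds (0:ℝ), 0 < R ^ 2 - ‖x + t • e‖ ^ 2 :=
      hl0.eventually ((by fun_prop : Continuous fun y : EuclideanSpace ℝ (Fin m) =>
        R ^ 2 - ‖y‖ ^ 2).continuousAt.eventually (lt_mem_nhds hD))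
    have hm2 : IsLocalMax (fun t : ℝ => Real.log (u (x + t • e)) - h (x + t • e)
        + γ * Real.log (R ^ 2 - ‖x + t • e‖ ^ 2)) 0 := by
      have := hl0.eventually hmax
      filter_upwards [this] with t ht
      simpa using ht
    have s1 := d2.div (d1 0) (by simpa using hux.ne')
    have s2 := hd2 i x 0
    have s3 := (n2.div (n1 0) (by simpa using hD.ne')).const_mul γ
    have := second_deriv_test (f' := fun t => fderiv ℝ u (x + t • e) e / u (x + t • e)
        - h' i (x + t • e) + γ * (-(2 * (x + t • e) i) / (R ^ 2 - ‖x + t • e‖ ^ 2))) hm2 ?_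
        ((s1.sub s2).add s3)
    · simp only [zero_smul, add_zero, ← he] at this
      refine le_of_eq_of_le ?_ this
      have hu0 := hux.ne'
      have hD0 := hD.ne'
      field_simp
      ring
    · filter_upwards [ev1, ev2] with t h1 h2
      exact (((d1 t).log h1.ne').sub (hd1 i x t)).add (((n1 t).log h2.ne').const_mul γ)
  have hsum := Finset.sum_nonpos fun i (_ : i ∈ Finset.univ) => key i
  refine le_of_eq_of_le ?_ hsum
  have hn : ∑ i, (x i) ^ 2 = ‖x‖ ^ 2 := by
    rw [EuclideanSpace.norm_sq_eq]; simp
  rw [norm_gradient_sq, lap, ← hn]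
  simp only [Finset.sum_sub_distrib, ← Finset.mul_sum, Finset.sum_add_distrib, ← Finset.sum_div,
    Finset.sum_const, Finset.card_univ, Fintype.card_fin, nsmul_eq_mul]
  ring

set_option maxHeartbeats 800000 in
lemma growth_bound {m : ℕ} {R σ : ℝ} {a b u h : EuclideanSpace ℝ (Fin m) → ℝ}
    {h' h'' : Fin m → EuclideanSpace ℝ (Fin m) → ℝ} {x₀ : EuclideanSpace ℝ (Fin m)} {A B M : ℝ}
    (hσ : 1 < σ) (hA : A ≤ -1) (hR : 0 < R) (hx₀ : ‖x₀‖ < R) (hB : 0 ≤ B)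
    (hb : ∀ x, ‖x‖ ≤ R → B ≤ b x)
    (hu : ContDiff ℝ 2 u) (hu0 : ∀ x, 0 ≤ u x) (hux : 0 < u x₀)
    (hineq : ∀ x, b x * u x ^ (σ + 1) - A * ‖gradient u x‖ ^ 2
        ≤ u x * lap u x + a x * u x ^ 2)
    (hc : Continuous h) (hh0 : ∀ x, 0 ≤ h x) (hhM : h x₀ ≤ M)
    (hd1 : ∀ i x t, HasDerivAt (fun t : ℝ => h (x + t • EuclideanSpace.single i (1:ℝ)))
        (h' i (x + t • EuclideanSpace.single i (1:ℝ))) t)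
    (hd2 : ∀ i x t, HasDerivAt (fun t : ℝ => h' i (x + t • EuclideanSpace.single i (1:ℝ)))
        (h'' i (x + t • EuclideanSpace.single i (1:ℝ))) t)
    (hlap : ∀ x, ∑ i, h'' i x ≤ - max (a x) 0 + (R ^ 2)⁻¹) :
    B * ((u x₀ * Real.exp (-M)) ^ (σ - 1) * (R ^ 2 - ‖x₀‖ ^ 2) ^ 2) ≤
      (1 + 2 / (σ - 1) * (2 * m + 4)) * R ^ 2 := by
  set β := σ - 1 with hβ
  have hβ0 : 0 < β := by rw [hβ]; linarith
  set γ := 2 / β with hγ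
  have hγ0 : 0 < γ := by positivity
  have hγβ : γ * β = (2 : ℕ) := by rw [hγ]; push_cast; field_simp
  have hD0 : 0 < R ^ 2 - ‖x₀‖ ^ 2 := by nlinarith [norm_nonneg x₀]
  set Φ : EuclideanSpace ℝ (Fin m) → ℝ := fun x =>
    u x * Real.exp (-h x) * (R ^ 2 - ‖x‖ ^ 2) ^ γ with hΦ
  have hΦc : Continuous Φ := by
    have h1 : Continuous fun x : EuclideanSpace ℝ (Fin m) => (R ^ 2 - ‖x‖ ^ 2) ^ γ :=
      (by fun_prop : Continuous fun x : EuclideanSpace ℝ (Fin m) => R ^ 2 - ‖x‖ ^ 2).rpow_const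
        fun _ => Or.inr hγ0.le
    have h2 := hu.continuous
    fun_prop
  obtain ⟨x, hxR, hxmax⟩ := (isCompact_closedBall (0 : EuclideanSpace ℝ (Fin m)) R).exists_isMaxOn
    ⟨x₀, by simpa using hx₀.le⟩ hΦc.continuousOn
  have hxR : ‖x‖ ≤ R := by simpa using hxR
  have hΦ0 : 0 < Φ x₀ := by
    have := Real.rpow_pos_of_pos hD0 γ
    positivity
  have hle : Φ x₀ ≤ Φ x := hxmax (by simpa using hx₀.le)
  have hΦx : 0 < Φ x := hΦ0.trans_le hle
  have hDx0 : 0 ≤ R ^ 2 - ‖x‖ ^ 2 := by nlinarith [norm_nonneg x]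
  have huxp : 0 < u x := by
    rcases eq_or_lt_of_le (hu0 x) with h0 | h0
    · simp [hΦ, ← h0] at hΦx
    · exact h0
  have hDx : 0 < R ^ 2 - ‖x‖ ^ 2 := by
    rcases eq_or_lt_of_le hDx0 with h0 | h0
    · simp [hΦ, ← h0, Real.zero_rpow hγ0.ne'] at hΦx
    · exact h0
  have hlogΦ : ∀ y, 0 < u y → 0 < R ^ 2 - ‖y‖ ^ 2 →
      Real.log (u y) - h y + γ * Real.log (R ^ 2 - ‖y‖ ^ 2) = Real.log (Φ y) := by
    intro y h1 h2
    have h3 := Real.rpow_pos_of_pos h2 γ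
    rw [hΦ]
    simp only
    rw [Real.log_mul (by positivity) h3.ne', Real.log_mul h1.ne' (Real.exp_pos _).ne',
      Real.log_exp, Real.log_rpow h2]
    ring
  have hlm : IsLocalMax (fun y => Real.log (u y) - h y + γ * Real.log (R ^ 2 - ‖y‖ ^ 2)) x := by
    have ev1 : ∀ᶠ y in nhds x, 0 < u y := hu.continuous.continuousAt.eventually (lt_mem_nhds huxp)
    have ev2 : ∀ᶠ y in nhds x, 0 < R ^ 2 - ‖y‖ ^ 2 :=
      ((by fun_prop : Continuous fun y : EuclideanSpace ℝ (Fin m) =>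
        R ^ 2 - ‖y‖ ^ 2).continuousAt.eventually (lt_mem_nhds hDx))
    filter_upwards [ev1, ev2] with y h1 h2
    change Real.log (u y) - h y + γ * Real.log (R ^ 2 - ‖y‖ ^ 2) ≤
      Real.log (u x) - h x + γ * Real.log (R ^ 2 - ‖x‖ ^ 2)
    rw [hlogΦ y h1 h2, hlogΦ x huxp hDx]
    have h3 := Real.rpow_pos_of_pos h2 γ
    refine Real.log_le_log (by positivity) (hxmax ?_)
    have : ‖y‖ < R := lt_of_pow_lt_pow_left₀ 2 hR.le (by linarith)
    simpa using this.le
  have hmain := log_max_ineq hu (by linarith) huxp hd1 hd2 hlm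
  have hin := hineq x
  have hpow : u x ^ (σ + 1) = u x ^ β * u x ^ 2 := by
    rw [← Real.rpow_natCast (u x) 2, ← Real.rpow_add huxp, hβ]; congr 1; push_cast; ring
  rw [hpow] at hin
  have hin2 : b x * u x ^ β ≤ lap u x / u x - ‖gradient u x‖ ^ 2 / (u x) ^ 2 + a x := by
    have e : lap u x / u x - ‖gradient u x‖ ^ 2 / (u x) ^ 2 + a x =
        (u x * lap u x + a x * u x ^ 2 - ‖gradient u x‖ ^ 2) / u x ^ 2 := by
      field_simp
      ring
    rw [e, le_div_iff₀ (by positivity)]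
    nlinarith [sq_nonneg ‖gradient u x‖]
  set D := R ^ 2 - ‖x‖ ^ 2 with hDdef
  have hup := Real.rpow_pos_of_pos huxp β
  have hfin : B * u x ^ β ≤ (R ^ 2)⁻¹ + γ * (2 * m / D + 4 * ‖x‖ ^ 2 / D ^ 2) := by
    have h1 := hlap x
    have h2 := le_max_left (a x) 0
    have h3 : B * u x ^ β ≤ b x * u x ^ β := by gcongr; exact hb x hxR
    linarith
  have hDR : D ≤ R ^ 2 := by rw [hDdef]; nlinarith [sq_nonneg ‖x‖]
  have hfin2 : B * (u x ^ β * D ^ 2) ≤ (1 + γ * (2 * m + 4)) * R ^ 2 := by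
    have h1 := mul_le_mul_of_nonneg_right hfin (sq_nonneg D)
    have h2 : ((R ^ 2)⁻¹ + γ * (2 * m / D + 4 * ‖x‖ ^ 2 / D ^ 2)) * D ^ 2 =
        (R ^ 2)⁻¹ * D ^ 2 + γ * (2 * m * D + 4 * ‖x‖ ^ 2) := by
      field_simp
    have h3 : (R ^ 2)⁻¹ * D ^ 2 ≤ R ^ 2 := by
      rw [inv_mul_le_iff₀ (by positivity), sq D]
      exact mul_le_mul hDR hDR hDx.le (sq_nonneg R)
    have h4 : γ * (2 * m * D + 4 * ‖x‖ ^ 2) ≤ γ * (2 * m * R ^ 2 + 4 * R ^ 2) := by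
      gcongr
    linarith
  refine le_trans ?_ hfin2
  refine mul_le_mul_of_nonneg_left ?_ hB
  have hpw : ∀ v d : ℝ, 0 ≤ v → 0 ≤ d → (v * d ^ γ) ^ β = v ^ β * d ^ 2 := by
    intro v d hv hd
    rw [Real.mul_rpow hv (Real.rpow_nonneg hd _), ← Real.rpow_mul hd, hγβ, Real.rpow_natCast]
  rw [← hpw _ _ (by positivity) hD0.le, ← hpw _ _ huxp.le hDx.le]
  have hDp := Real.rpow_pos_of_pos hD0 γ
  have hDp' := Real.rpow_pos_of_pos hDx γ
  refine Real.rpow_le_rpow (by positivity) ?_ hβ0.le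
  calc u x₀ * Real.exp (-M) * (R ^ 2 - ‖x₀‖ ^ 2) ^ γ ≤ Φ x₀ := by
        rw [hΦ]; simp only; gcongr
    _ ≤ Φ x := hle
    _ ≤ u x * 1 * D ^ γ := by
        rw [hΦ]; simp only
        gcongr
        exact Real.exp_le_one_iff.2 (by linarith [hh0 x])
    _ = _ := by ring

/-- nonexistence under integrability of the positive part of `a`
(Euclidean case, `m ≥ 3`). -/
theorem stmt_16 {m : ℕ} (hm : 3 ≤ m) (a b : EuclideanSpace ℝ (Fin m) → ℝ)
    (α : ℝ) (hα : α ∈ Set.Ioo (0:ℝ) 1) (Ca : NNReal) (haH : HolderWith Ca α.toNNReal a)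
    (haInt : Integrable (fun x => max (a x) 0))
    (hbcont : Continuous b) (hbpos : ∀ x, 0 < b x)
    (σ A μ p q : ℝ) (hσ : 1 < σ) (hA : A ≤ -1)
    (hq : max 1 (3 - σ) < q) (hμ0 : 0 ≤ μ) (hμ : μ ≤ 2 * (σ - 1) / (σ + q - 2))
    (hp : (q + σ - 2) / (σ - 1) < p)
    (haO : ∃ C₁ r₁ : ℝ, ∀ r ≥ r₁,
      (∫ x in ball (0 : EuclideanSpace ℝ (Fin m)) r, max (a x) 0 ^ p)
        ≤ C₁ * r ^ ((2 * (σ - 1) - μ * (q + σ - 2)) * (p - 1) / (q - 1)))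
    (hvol : (m : ℝ) ≤ 2 + (2 - μ) * (σ + q - 2) / (σ - 1))
    (hblow : ∃ C > (0:ℝ), ∃ r₀ : ℝ, ∀ x : EuclideanSpace ℝ (Fin m),
      r₀ ≤ ‖x‖ → C * ‖x‖ ^ (-μ) ≤ b x) :
    ¬ ∃ u : EuclideanSpace ℝ (Fin m) → ℝ, ContDiff ℝ 2 u ∧ (∀ x, 0 ≤ u x) ∧
      (∃ x, u x ≠ 0) ∧
      ∀ x, b x * u x ^ (σ + 1) - A * ‖gradient u x‖ ^ 2
        ≤ u x * lap u x + a x * u x ^ 2 := by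
  rintro ⟨u, hu, hu0, ⟨x₀, hx₀⟩, hineq⟩
  have hux : 0 < u x₀ := lt_of_le_of_ne (hu0 x₀) (Ne.symm hx₀)
  have hα0 : (α.toNNReal : ℝ) = α := Real.coe_toNNReal α hα.1.le
  have hac : Continuous a := haH.continuous (by simpa using hα.1)
  have hH : ∀ x y, |max (a x) 0 - max (a y) 0| ≤ (Ca : ℝ) * ‖x - y‖ ^ α := by
    intro x y
    have h1 := haH.dist_le x y
    rw [hα0, Real.dist_eq, dist_eq_norm] at h1
    exact (abs_max_sub_max_le_abs _ _ _).trans h1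
  obtain ⟨M, hM⟩ := potential_exists hm haInt (fun x => le_max_right _ _)
    (hac.max continuous_const) Ca.2 hα.1 hα.2 hH x₀
  obtain ⟨c, hc, hb⟩ := b_lower hbcont hbpos hμ0 hblow
  have hq1 : 1 < q := (le_max_left _ _).trans_lt hq
  have hμ2 : 0 < 2 - μ := by
    have : 2 * (σ - 1) / (σ + q - 2) < 2 := by
      rw [div_lt_iff₀ (by linarith)]; linarith
    linarith
  set η := (u x₀ * Real.exp (-M)) ^ (σ - 1) with hη
  have hη0 : 0 < η := Real.rpow_pos_of_pos (by positivity) _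
  set K := 1 + 2 / (σ - 1) * (2 * m + 4) with hK
  have hlim := tendsto_rpow_atTop hμ2
  obtain ⟨R, hR1, hR2, hR3⟩ := ((eventually_ge_atTop (1:ℝ)).and
    ((eventually_ge_atTop (2 * ‖x₀‖)).and (hlim.eventually (eventually_gt_atTop (4 * K / (c * η)))))).exists
  have hRpos : 0 < R := by linarith
  obtain ⟨h, h', h'', hhc, hh0, hhM, hd1, hd2, hlap⟩ := hM (R ^ 2)⁻¹ (by positivity)
  have hRμ : 0 < R ^ (-μ) := Real.rpow_pos_of_pos hRpos _
  have hgb := growth_bound hσ hA hRpos (by linarith [norm_nonneg x₀]) (by positivity)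
    (hb R hR1) hu hu0 hux hineq hhc hh0 hhM hd1 hd2 hlap
  rw [← hη, ← hK] at hgb
  have hsq : (R ^ 2 / 2) ^ 2 ≤ (R ^ 2 - ‖x₀‖ ^ 2) ^ 2 := by
    have : R ^ 2 / 2 ≤ R ^ 2 - ‖x₀‖ ^ 2 := by nlinarith [norm_nonneg x₀]
    gcongr
  have h1 : c * R ^ (-μ) * (η * (R ^ 2 / 2) ^ 2) ≤ K * R ^ 2 := le_trans (by gcongr) hgb
  have h2 : R ^ (2 - μ) = R ^ 2 * R ^ (-μ) := by
    rw [← Real.rpow_natCast R 2, ← Real.rpow_add hRpos]; congr 1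
  rw [div_lt_iff₀ (by positivity), h2] at hR3
  have hR2p : 0 < R ^ 2 := by positivity
  nlinarith [mul_lt_mul_of_pos_right hR3 hR2p]
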